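/- Let A = U − V be a proper regular splitting of a real m×n matrix A with A† ≥ 0. Then: (a) A† ≥ U† (entrywise); (b) ρ(A†V) ≥ ρ(U†V); and (c) ρ(U†V) = ρ(A†V)/(1 + ρ(A†V)) < 1. -/

import Mathlib

open Matrix

/-- `G` is the Moore-Penrose inverse of `A` (the four Penrose equations). -/
def IsMoorePenrose {m n : ℕ} (A : Matrix (Fin m) (Fin n) ℝ)
    (G : Matrix (Fin n) (Fin m) ℝ) : Prop :=
  A * G * A = A ∧ G * A * G = G ∧ (A * G)ᵀ = A * G ∧ (G * A)ᵀ = G * A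

/-- `A = U - V` is a proper splitting: `range U = range A` and `null U = null A`. -/
def IsProperSplitting {m n : ℕ} (A U V : Matrix (Fin m) (Fin n) ℝ) : Prop :=
  A = U - V ∧
    LinearMap.range U.mulVecLin = LinearMap.range A.mulVecLin ∧
    LinearMap.ker U.mulVecLin = LinearMap.ker A.mulVecLin

/-- The spectral radius of a real square matrix: the maximum modulus of its
complex eigenvalues. -/
noncomputable def specRad {k : ℕ} (X : Matrix (Fin k) (Fin k) ℝ) : ℝ :=
  (spectralRadius ℂ (X.map Complex.ofReal)).toReal

section MoorePenrose

variable {m n : ℕ} {A U V : Matrix (Fin m) (Fin n) ℝ} {Ad Ud : Matrix (Fin n) (Fin m) ℝ}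

/-- If the null space of `A` lies in that of `U`, then `U` is unchanged by composition with the
projection `Ad * A`. -/
lemma IsMoorePenrose.mul_mul_eq_of_ker_le (hA : IsMoorePenrose A Ad)
    (h : LinearMap.ker A.mulVecLin ≤ LinearMap.ker U.mulVecLin) : U * (Ad * A) = U := by
  refine Matrix.ext_of_mulVec_single fun j => ?_
  have hk : Pi.single j 1 - (Ad * A) *ᵥ Pi.single j 1 ∈ LinearMap.ker A.mulVecLin := by
    rw [LinearMap.mem_ker, Matrix.mulVecLin_apply, Matrix.mulVec_sub, Matrix.mulVec_mulVec,
      ← Matrix.mul_assoc, hA.1, sub_self]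
  have hU := h hk
  rw [LinearMap.mem_ker, Matrix.mulVecLin_apply, Matrix.mulVec_sub, Matrix.mulVec_mulVec,
    sub_eq_zero] at hU
  exact hU.symm

/-- If the range of `U` lies in that of `A`, then `U` is unchanged by composition with the
projection `A * Ad`. -/
lemma IsMoorePenrose.mul_mul_eq_of_range_le (hA : IsMoorePenrose A Ad)
    (h : LinearMap.range U.mulVecLin ≤ LinearMap.range A.mulVecLin) : A * Ad * U = U := by
  refine Matrix.ext_of_mulVec_single fun j => ?_
  obtain ⟨w, hw⟩ := h (LinearMap.mem_range_self U.mulVecLin (Pi.single j 1))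
  rw [Matrix.mulVecLin_apply, Matrix.mulVecLin_apply] at hw
  rw [← Matrix.mulVec_mulVec, ← hw, Matrix.mulVec_mulVec, hA.1]

lemma IsMoorePenrose.mul_eq_of_ker_eq (hA : IsMoorePenrose A Ad) (hU : IsMoorePenrose U Ud)
    (h : LinearMap.ker U.mulVecLin = LinearMap.ker A.mulVecLin) : Ud * U = Ad * A := by
  have h₁ : Ud * U * (Ad * A) = Ud * U := by
    rw [Matrix.mul_assoc, hA.mul_mul_eq_of_ker_le h.ge]
  have h₂ : Ad * A * (Ud * U) = Ad * A := by
    rw [Matrix.mul_assoc, hU.mul_mul_eq_of_ker_le h.le]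
  have h₃ := congrArg Matrix.transpose h₁
  rw [Matrix.transpose_mul, hA.2.2.2, hU.2.2.2] at h₃
  exact h₃.symm.trans h₂

lemma IsMoorePenrose.mul_eq_of_range_eq (hA : IsMoorePenrose A Ad) (hU : IsMoorePenrose U Ud)
    (h : LinearMap.range U.mulVecLin = LinearMap.range A.mulVecLin) : U * Ud = A * Ad := by
  have h₁ : A * Ad * (U * Ud) = U * Ud := by
    rw [← Matrix.mul_assoc, hA.mul_mul_eq_of_range_le h.le]
  have h₂ : U * Ud * (A * Ad) = A * Ad := by
    rw [← Matrix.mul_assoc, hU.mul_mul_eq_of_range_le h.ge]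
  have h₃ := congrArg Matrix.transpose h₁
  rw [Matrix.transpose_mul, hA.2.2.1, hU.2.2.1] at h₃
  exact h₃.symm.trans h₂

lemma IsProperSplitting.sub_eq_mul_mul (hA : IsMoorePenrose A Ad) (hU : IsMoorePenrose U Ud)
    (hPS : IsProperSplitting A U V) : Ad - Ud = Ad * V * Ud := by
  have hV : V = U - A := by rw [hPS.1, sub_sub_cancel]
  rw [hV, Matrix.mul_sub, Matrix.sub_mul, ← hA.mul_eq_of_ker_eq hU hPS.2.2, hU.2.1,
    Matrix.mul_assoc, hA.mul_eq_of_range_eq hU hPS.2.1, ← Matrix.mul_assoc, hA.2.1]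

lemma IsProperSplitting.one_add_mul_one_sub (hA : IsMoorePenrose A Ad)
    (hU : IsMoorePenrose U Ud) (hPS : IsProperSplitting A U V) :
    (1 + Ad * V) * (1 - Ud * V) = 1 := by
  have h : Ad * V * (Ud * V) = Ad * V - Ud * V := by
    rw [← Matrix.mul_assoc, ← hPS.sub_eq_mul_mul hA hU, Matrix.sub_mul]
  rw [mul_sub, mul_one, add_mul, one_mul, h]
  abel

end MoorePenrose

lemma Matrix.mul_nonneg_of_nonneg {l m n : Type*} [Fintype m] {A : Matrix l m ℝ}
    {B : Matrix m n ℝ} (hA : ∀ i j, 0 ≤ A i j) (hB : ∀ i j, 0 ≤ B i j) (i : l) (j : n) :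
    0 ≤ (A * B) i j :=
  Finset.sum_nonneg fun k _ => mul_nonneg (hA i k) (hB k j)

lemma Matrix.mulVec_mono_of_nonneg {m n : Type*} [Fintype n] {A : Matrix m n ℝ}
    (hA : ∀ i j, 0 ≤ A i j) {x y : n → ℝ} (hxy : x ≤ y) : A *ᵥ x ≤ A *ᵥ y :=
  fun i => Finset.sum_le_sum fun j _ => mul_le_mul_of_nonneg_left (hxy j) (hA i j)

section SpectralRadius

attribute [local instance] Matrix.linftyOpNormedRing Matrix.linftyOpNormedAlgebra

variable {k : ℕ} {X : Matrix (Fin k) (Fin k) ℝ}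

lemma specRad_nonneg : 0 ≤ specRad X := ENNReal.toReal_nonneg

lemma mem_spectrum_iff_exists_mulVec {M : Matrix (Fin k) (Fin k) ℂ} {μ : ℂ} :
    μ ∈ spectrum ℂ M ↔ ∃ v ≠ 0, M *ᵥ v = μ • v := by
  rw [← Matrix.spectrum_toLin', ← Module.End.hasEigenvalue_iff_mem_spectrum]
  constructor
  · intro h
    obtain ⟨v, hv⟩ := h.exists_hasEigenvector
    exact ⟨v, hv.2, by simpa using hv.apply_eq_smul⟩
  · rintro ⟨v, hv, h⟩
    exact Module.End.hasEigenvalue_of_hasEigenvector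
      ⟨Module.End.mem_eigenspace_iff.2 (by simpa using h), hv⟩

lemma spectralRadius_map_ne_top : spectralRadius ℂ (X.map Complex.ofReal) ≠ ⊤ := by
  rcases Nat.eq_zero_or_pos k with rfl | hk
  · simp [spectrum.SpectralRadius.of_subsingleton]
  · have : NeZero k := ⟨hk.ne'⟩
    exact (spectrum.spectralRadius_le_nnnorm _).trans_lt ENNReal.coe_lt_top |>.ne

/-- The modulus of an eigenvalue is at most the spectral radius. -/
lemma norm_le_specRad {μ : ℂ} {v : Fin k → ℂ} (hv : v ≠ 0)
    (h : X.map Complex.ofReal *ᵥ v = μ • v) : ‖μ‖ ≤ specRad X := by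
  have hle : (‖μ‖₊ : ENNReal) ≤ spectralRadius ℂ (X.map Complex.ofReal) :=
    le_iSup₂_of_le μ (mem_spectrum_iff_exists_mulVec.2 ⟨v, hv, h⟩) le_rfl
  simpa [specRad] using ENNReal.toReal_mono spectralRadius_map_ne_top hle

/-- The spectral radius is the modulus of some eigenvalue. -/
lemma exists_norm_eq_specRad [NeZero k] (X : Matrix (Fin k) (Fin k) ℝ) :
    ∃ (μ : ℂ) (v : Fin k → ℂ), v ≠ 0 ∧ X.map Complex.ofReal *ᵥ v = μ • v ∧ ‖μ‖ = specRad X := by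
  obtain ⟨μ, hμ, h⟩ := spectrum.exists_nnnorm_eq_spectralRadius (X.map Complex.ofReal)
  obtain ⟨v, hv, hv'⟩ := mem_spectrum_iff_exists_mulVec.1 hμ
  exact ⟨μ, v, hv, hv', by simp [specRad, ← h]⟩

lemma map_ofReal_mulVec (X : Matrix (Fin k) (Fin k) ℝ) (y : Fin k → ℝ) :
    X.map Complex.ofReal *ᵥ (fun i => (y i : ℂ)) = fun i => ((X *ᵥ y) i : ℂ) := by
  ext i
  simp [Matrix.mulVec, dotProduct]

/-- The Collatz–Wielandt lower bound for the spectral radius of a nonnegative matrix. -/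
lemma le_specRad_of_smul_le_mulVec (hX : ∀ i j, 0 ≤ X i j) {a : ℝ} (ha : 0 ≤ a)
    {y : Fin k → ℝ} (hy : 0 ≤ y) (hy0 : y ≠ 0) (h : a • y ≤ X *ᵥ y) : a ≤ specRad X := by
  have hpow : ∀ p : ℕ, a ^ p • y ≤ (X ^ p) *ᵥ y := by
    intro p
    induction p with
    | zero => simp
    | succ p ih =>
      calc a ^ (p + 1) • y = a ^ p • (a • y) := by rw [pow_succ, mul_smul]
        _ ≤ a ^ p • (X *ᵥ y) := smul_le_smul_of_nonneg_left h (pow_nonneg ha p)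
        _ = X *ᵥ (a ^ p • y) := (Matrix.mulVec_smul _ _ _).symm
        _ ≤ X *ᵥ ((X ^ p) *ᵥ y) := Matrix.mulVec_mono_of_nonneg hX ih
        _ = (X ^ (p + 1)) *ᵥ y := by rw [Matrix.mulVec_mulVec, pow_succ']
  have hnorm : ∀ p : ℕ, a ^ p ≤ ‖X.map Complex.ofReal ^ p‖ := by
    intro p
    have hmap : X.map Complex.ofReal ^ p = (X ^ p).map Complex.ofReal :=
      (Matrix.map_pow X Complex.ofRealHom p).symm
    have hofReal : ∀ z : Fin k → ℝ, ‖fun i => (z i : ℂ)‖ = ‖z‖ := fun z => by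
      simp [Pi.norm_def]
    have hle : a ^ p * ‖y‖ ≤ ‖X.map Complex.ofReal ^ p‖ * ‖y‖ := by
      calc a ^ p * ‖y‖ = ‖a ^ p • y‖ := by
            rw [norm_smul, Real.norm_of_nonneg (pow_nonneg ha p)]
        _ ≤ ‖(X ^ p) *ᵥ y‖ := by
            refine (pi_norm_le_iff_of_nonneg (norm_nonneg _)).2 fun i => ?_
            have h₀ : 0 ≤ (a ^ p • y) i := mul_nonneg (pow_nonneg ha p) (hy i)
            rw [Real.norm_of_nonneg h₀]
            exact (hpow p i).trans ((le_abs_self _).trans (norm_le_pi_norm ((X ^ p) *ᵥ y) i))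
        _ = ‖(X ^ p).map Complex.ofReal *ᵥ fun i => (y i : ℂ)‖ := by
            rw [map_ofReal_mulVec, hofReal]
        _ ≤ ‖(X ^ p).map Complex.ofReal‖ * ‖fun i => (y i : ℂ)‖ :=
            Matrix.linfty_opNorm_mulVec _ _
        _ = ‖X.map Complex.ofReal ^ p‖ * ‖y‖ := by rw [hmap, hofReal]
    exact le_of_mul_le_mul_right hle (norm_pos_iff.2 hy0)
  have hlim := spectrum.pow_norm_pow_one_div_tendsto_nhds_spectralRadius (X.map Complex.ofReal)
  have hge : ENNReal.ofReal a ≤ spectralRadius ℂ (X.map Complex.ofReal) := by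
    refine ge_of_tendsto hlim ?_
    filter_upwards [Filter.eventually_ne_atTop 0] with p hp
    refine ENNReal.ofReal_le_ofReal ?_
    calc a = (a ^ p) ^ (1 / p : ℝ) := by rw [one_div, Real.pow_rpow_inv_natCast ha hp]
      _ ≤ _ := Real.rpow_le_rpow (pow_nonneg ha p) (hnorm p) (by positivity)
  simpa [specRad, ENNReal.toReal_ofReal ha] using
    ENNReal.toReal_mono spectralRadius_map_ne_top hge

/-- The entrywise modulus of an eigenvector of a nonnegative matrix. -/
lemma norm_smul_le_mulVec_norm (hX : ∀ i j, 0 ≤ X i j) {μ : ℂ} {v : Fin k → ℂ}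
    (h : X.map Complex.ofReal *ᵥ v = μ • v) :
    ‖μ‖ • (fun i => ‖v i‖) ≤ X *ᵥ fun i => ‖v i‖ := by
  intro i
  calc ‖μ‖ * ‖v i‖ = ‖(X.map Complex.ofReal *ᵥ v) i‖ := by rw [h]; simp
    _ ≤ ∑ j, ‖(X i j : ℂ) * v j‖ := norm_sum_le Finset.univ fun j => (X i j : ℂ) * v j
    _ = (X *ᵥ fun i => ‖v i‖) i := by
      simp [Matrix.mulVec, dotProduct, abs_of_nonneg (hX i _)]

variable {B C : Matrix (Fin k) (Fin k) ℝ}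

/-- Inverting `1 - B` turns a subinvariance bound for `B` into one for `1 + C`. -/
lemma le_smul_one_add_mulVec (hC : ∀ i j, 0 ≤ C i j) (h : (1 + C) * (1 - B) = 1) {r : ℝ}
    {y : Fin k → ℝ} (hy : r • y ≤ B *ᵥ y) : y ≤ (1 - r) • (y + C *ᵥ y) := by
  have h₁ : (1 - B) *ᵥ y ≤ (1 - r) • y := by
    rw [Matrix.sub_mulVec, Matrix.one_mulVec, sub_smul, one_smul]
    exact sub_le_sub_left hy y
  calc y = (1 + C) *ᵥ ((1 - B) *ᵥ y) := by rw [Matrix.mulVec_mulVec, h, Matrix.one_mulVec]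
    _ = (1 - B) *ᵥ y + C *ᵥ ((1 - B) *ᵥ y) := by rw [Matrix.add_mulVec, Matrix.one_mulVec]
    _ ≤ (1 - r) • y + C *ᵥ ((1 - r) • y) :=
      add_le_add h₁ (Matrix.mulVec_mono_of_nonneg hC h₁)
    _ = (1 - r) • (y + C *ᵥ y) := by rw [Matrix.mulVec_smul, smul_add]

lemma specRad_lt_one_and_le (hB : ∀ i j, 0 ≤ B i j) (hC : ∀ i j, 0 ≤ C i j)
    (h : (1 + C) * (1 - B) = 1) [NeZero k] :
    specRad B < 1 ∧ specRad B / (1 - specRad B) ≤ specRad C := by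
  obtain ⟨μ, v, hv, hμ, hr⟩ := exists_norm_eq_specRad B
  set y : Fin k → ℝ := fun i => ‖v i‖
  have hy : 0 ≤ y := fun i => norm_nonneg _
  have hy0 : y ≠ 0 := fun h0 => hv (funext fun i => norm_eq_zero.1 (congrFun h0 i))
  have hle := le_smul_one_add_mulVec hC h (hr ▸ norm_smul_le_mulVec_norm hB hμ)
  have hCy : 0 ≤ C *ᵥ y := by
    simpa using Matrix.mulVec_mono_of_nonneg hC hy
  have hlt : specRad B < 1 := by
    by_contra! hge
    refine hy0 (le_antisymm (hle.trans ?_) hy)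
    exact smul_nonpos_of_nonpos_of_nonneg (sub_nonpos.2 hge) (add_nonneg hy hCy)
  have hpos : 0 < 1 - specRad B := sub_pos.2 hlt
  refine ⟨hlt, le_specRad_of_smul_le_mulVec hC (div_nonneg specRad_nonneg hpos.le) hy hy0 ?_⟩
  intro i
  have hi := hle i
  simp only [Pi.smul_apply, Pi.add_apply, smul_eq_mul] at hi ⊢
  rw [div_mul_eq_mul_div, div_le_iff₀ hpos]
  linarith

lemma specRad_le_mul_one_add (h : (1 + C) * (1 - B) = 1) [NeZero k] :
    specRad C ≤ specRad B * (1 + specRad C) := by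
  obtain ⟨μ, v, hv, hμ, hs⟩ := exists_norm_eq_specRad C
  have hmap : (1 - B.map Complex.ofReal) * (1 + C.map Complex.ofReal) = 1 := by
    have := congrArg (Complex.ofRealHom.mapMatrix) (mul_eq_one_comm.1 h)
    rwa [map_mul, map_sub, map_add, map_one] at this
  have hvec : (1 + μ) • (v - B.map Complex.ofReal *ᵥ v) = v := by
    have := congrArg (· *ᵥ v) hmap
    simp only [← Matrix.mulVec_mulVec, Matrix.add_mulVec, Matrix.one_mulVec, hμ] at this
    rwa [← one_smul ℂ v, smul_smul, mul_one, ← add_smul, Matrix.mulVec_smul, Matrix.sub_mulVec,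
      one_smul, Matrix.one_mulVec] at this
  have hne : 1 + μ ≠ 0 := by
    intro h0
    rw [h0, zero_smul] at hvec
    exact hv hvec.symm
  have heig : B.map Complex.ofReal *ᵥ v = (μ / (1 + μ)) • v := by
    have : (1 + μ) • B.map Complex.ofReal *ᵥ v = μ • v := by
      rw [smul_sub, add_smul 1 μ v, one_smul] at hvec
      rw [sub_eq_iff_eq_add] at hvec
      exact (add_left_cancel hvec).symm
    rw [div_eq_inv_mul, mul_smul, ← this, smul_smul, inv_mul_cancel₀ hne, one_smul]
  have hle := norm_le_specRad hv heig
  rw [norm_div, div_le_iff₀ (norm_pos_iff.2 hne), hs] at hle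
  refine hle.trans (mul_le_mul_of_nonneg_left ?_ specRad_nonneg)
  simpa [hs] using norm_add_le 1 μ

end SpectralRadius

theorem stmt5 {m n : ℕ} (A U V : Matrix (Fin m) (Fin n) ℝ)
    (Ad Ud : Matrix (Fin n) (Fin m) ℝ)
    (hA : IsMoorePenrose A Ad) (hU : IsMoorePenrose U Ud)
    (hPS : IsProperSplitting A U V)
    (hUd : ∀ i j, 0 ≤ Ud i j) (hV : ∀ i j, 0 ≤ V i j)
    (hAd : ∀ i j, 0 ≤ Ad i j) :
    (∀ i j, Ud i j ≤ Ad i j) ∧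
      specRad (Ud * V) ≤ specRad (Ad * V) ∧
      specRad (Ud * V) = specRad (Ad * V) / (1 + specRad (Ad * V)) ∧
      specRad (Ud * V) < 1 := by
  have hB := Matrix.mul_nonneg_of_nonneg hUd hV
  have hC := Matrix.mul_nonneg_of_nonneg hAd hV
  have hinv := hPS.one_add_mul_one_sub hA hU
  refine ⟨fun i j => ?_, ?_⟩
  · have h := Matrix.mul_nonneg_of_nonneg hC hUd i j
    rw [← hPS.sub_eq_mul_mul hA hU] at h
    exact sub_nonneg.1 h
  · rcases Nat.eq_zero_or_pos n with rfl | hn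
    · simp [specRad, spectrum.SpectralRadius.of_subsingleton]
    · have : NeZero n := ⟨hn.ne'⟩
      obtain ⟨hlt, hge⟩ := specRad_lt_one_and_le hB hC hinv
      have hle := specRad_le_mul_one_add hinv
      have hr := specRad_nonneg (X := Ud * V)
      have hs := specRad_nonneg (X := Ad * V)
      rw [div_le_iff₀ (sub_pos.2 hlt)] at hge
      refine ⟨by nlinarith, ?_, hlt⟩
      rw [eq_div_iff (by positivity)]
      linarith
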